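/- Let w : ℝ → ℂ be a Schwartz function and let y ∈ ℝ. Then Σ_{k ∈ ℤ, k odd} i^k·w(k)·e(ky) = i·e(y)·Σ_{ν ∈ ℤ} ŵ₁(ν − 2y − 1/2), where w₁(x) = w(1 + 2x), both series converging absolutely. Here i^k = exp(iπk/2). -/

import Mathlib

open Complex Real

noncomputable def e (x : ℝ) : ℂ := Complex.exp (2 * Real.pi * Complex.I * x)

open scoped SchwartzMap FourierTransform

theorem e_add (x y : ℝ) : e (x + y) = e x * e y := by
  simp only [e, ← Complex.exp_add]
  push_cast
  ring_nf

theorem norm_e (x : ℝ) : ‖e x‖ = 1 := by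
  rw [e, show 2 * (Real.pi : ℂ) * Complex.I * x = ((2 * Real.pi * x : ℝ) : ℂ) * Complex.I by
    push_cast; ring]
  exact Complex.norm_exp_ofReal_mul_I _

theorem continuous_e : Continuous e := by
  unfold e
  fun_prop

theorem SchwartzMap.summable_intCast (u : 𝓢(ℝ, ℂ)) : Summable fun n : ℤ => u n :=
  summable_of_isBigO (Real.summable_abs_int_rpow one_lt_two)
    ((u.isBigO_cocompact_rpow (-2)).comp_tendsto Int.tendsto_coe_cofinite)

theorem fourier_mul_e (u : ℝ → ℂ) (c t : ℝ) :
    𝓕 (fun x => u x * e (x * c)) t = ∫ x : ℝ, u x * e (-(x * (t - c))) := by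
  rw [Real.fourier_real_eq_integral_exp_smul]
  congr 1
  ext x
  rw [show -(x * (t - c)) = -(x * t) + x * c by ring, e_add, smul_eq_mul]
  rw [show Complex.exp (↑(-2 * Real.pi * x * t) * Complex.I) = e (-(x * t)) by
    unfold e; push_cast; ring_nf]
  ring

theorem integral_mul_e_eq_fourier (u : ℝ → ℂ) (t : ℝ) :
    ∫ x : ℝ, u x * e (-(x * t)) = 𝓕 u t := by
  simpa [e] using (fourier_mul_e u 0 t).symm

theorem SchwartzMap.summable_integral_mul_e (u : 𝓢(ℝ, ℂ)) (c : ℝ) :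
    Summable fun n : ℤ => ∫ x : ℝ, u x * e (-(x * (n - c))) := by
  simpa [integral_mul_e_eq_fourier, SchwartzMap.fourier_coe] using
    ((𝓕 u).compSubConstCLM ℝ c).summable_intCast

/-- Poisson summation for a Schwartz function twisted by an additive character. -/
theorem SchwartzMap.tsum_mul_e (u : 𝓢(ℝ, ℂ)) (c : ℝ) :
    ∑' n : ℤ, u n * e (n * c) = ∑' n : ℤ, ∫ x : ℝ, u x * e (-(x * (n - c))) := by
  have h := Real.tsum_eq_tsum_fourier_of_rpow_decay_of_summable
    (f := fun x => u x * e (x * c))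
    (u.continuous.mul (continuous_e.comp (continuous_id.mul continuous_const))) one_lt_two
    (.trans (g := u) (.of_bound' (.of_forall fun x => by simp [norm_e])) (u.isBigO_cocompact_rpow (-2)))
    (by simpa only [fourier_mul_e] using u.summable_integral_mul_e c) 0
  simpa [fourier_mul_e] using h

/-- The Schwartz function `x ↦ w (1 + 2 * x)`. -/
noncomputable def SchwartzMap.compOddAffine (w : 𝓢(ℝ, ℂ)) : 𝓢(ℝ, ℂ) :=
  SchwartzMap.compCLMOfContinuousLinearEquiv ℝ
    (ContinuousLinearEquiv.unitsEquivAut ℝ (Units.mk0 2 two_ne_zero))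
    (w.compSubConstCLM ℝ (-1))

theorem SchwartzMap.compOddAffine_apply (w : 𝓢(ℝ, ℂ)) (x : ℝ) :
    w.compOddAffine x = w (1 + 2 * x) := by
  simp [SchwartzMap.compOddAffine, add_comm, mul_comm]

theorem exp_mul_e_odd (y : ℝ) (m : ℤ) :
    Complex.exp (Complex.I * Real.pi * (1 + 2 * m : ℤ) / 2) * e ((1 + 2 * m : ℤ) * y) =
      Complex.I * e y * e (m * (2 * y + 1 / 2)) := by
  conv_rhs => rw [← Complex.exp_pi_div_two_mul_I]
  simp only [e, ← Complex.exp_add]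
  push_cast
  ring_nf

theorem stmt7 (w : SchwartzMap ℝ ℂ) (y : ℝ) :
    Summable (fun k : ℤ =>
      ‖if Odd k then Complex.exp (Complex.I * Real.pi * k / 2) * w k * e (k * y) else 0‖) ∧
    Summable (fun ν : ℤ =>
      ‖∫ x : ℝ, w (1 + 2 * x) * e (-(x * ((ν : ℝ) - 2 * y - 1 / 2)))‖) ∧
    (∑' k : ℤ, if Odd k then Complex.exp (Complex.I * Real.pi * k / 2) * w k * e (k * y) else 0)
      = Complex.I * e y *
        ∑' ν : ℤ, ∫ x : ℝ, w (1 + 2 * x) * e (-(x * ((ν : ℝ) - 2 * y - 1 / 2))) := by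
  simp only [← SchwartzMap.compOddAffine_apply, sub_sub]
  refine ⟨?_, (w.compOddAffine.summable_integral_mul_e (2 * y + 1 / 2)).norm, ?_⟩
  · refine w.summable_intCast.norm.of_nonneg_of_le (fun _ => norm_nonneg _) fun k => ?_
    split_ifs
    · rw [show Complex.I * Real.pi * k / 2 = ((Real.pi * k / 2 : ℝ) : ℂ) * Complex.I by
        push_cast; ring]
      rw [norm_mul, norm_mul, norm_e, Complex.norm_exp_ofReal_mul_I, one_mul, mul_one]
    · simp
  · rw [← SchwartzMap.tsum_mul_e, ← tsum_mul_left]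
    have hinj : Function.Injective fun m : ℤ => 1 + 2 * m := fun a b h => by
      dsimp only at h
      omega
    rw [← hinj.tsum_eq]
    · refine tsum_congr fun m => ?_
      rw [if_pos ⟨m, by ring⟩, mul_right_comm, exp_mul_e_odd, w.compOddAffine_apply]
      push_cast
      ring
    · intro k hk
      have hodd : Odd k := by
        by_contra h
        simp [h] at hk
      obtain ⟨m, rfl⟩ := hodd
      exact ⟨m, by ring⟩
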